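/- arXiv:2108.13060 — 2 statements merged into one kernel-verified Lean document; each statement's English description precedes it below -/
import Mathlib

section
/- For every even integer n with n ≥ 8 and n ≡ 0 (mod 4), and every n×n distance matrix D on the n teams (symmetric, nonnegative, zero diagonal, satisfying the triangle inequality), there exists a feasible TTP-2 schedule whose total traveling distance is at most (1 + 3/n − 6/(n(n−2))) · (2·D_G + n·D_M), where D_G is the sum of D over all unordered pairs of teams and D_M is the minimum weight of a perfect matching of the complete graph on the n teams with edge weights D. -/
open Finset

/-- `D` is a distance matrix: zero diagonal, symmetric, nonnegative,
and satisfying the triangle inequality. -/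
def IsDistMatrix {n : ℕ} (D : Fin n → Fin n → ℝ) : Prop :=
  (∀ i, D i i = 0) ∧ (∀ i j, D i j = D j i) ∧ (∀ i j, 0 ≤ D i j) ∧
    (∀ i j k, D i j ≤ D i k + D k j)

/-- A perfect matching of the complete graph on `Fin n`, represented as a
fixed-point-free involution sending each vertex to its partner. -/
def IsPM {n : ℕ} (p : Fin n → Fin n) : Prop :=
  (∀ i, p (p i) = i) ∧ ∀ i, p i ≠ i

/-- The weight of a perfect matching `p` w.r.t. the (symmetric) weights `D`:
each matching edge `{i, p i}` is counted twice in the sum, hence the division by 2. -/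
noncomputable def pmWeight {n : ℕ} (D : Fin n → Fin n → ℝ) (p : Fin n → Fin n) : ℝ :=
  (∑ i, D i (p i)) / 2

/-- `D_G`: the sum of `D` over all unordered pairs of distinct vertices. -/
noncomputable def sumPairs {n : ℕ} (D : Fin n → Fin n → ℝ) : ℝ :=
  (∑ i, ∑ j ∈ Finset.univ \ {i}, D i j) / 2

/-- A feasible TTP-2 schedule on `n` teams.  On each of the `2*(n-1)` days
(indexed `0, …, 2*(n-1)-1`) the teams are partitioned into `n/2` games:
`opp d i` is the opponent of team `i` on day `d` (so each team plays exactly one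
game per day) and `home d i` tells whether team `i` plays that game at home. -/
structure TTP2Schedule (n : ℕ) where
  opp : ℕ → Fin n → Fin n
  home : ℕ → Fin n → Bool
  /-- no team plays itself -/
  opp_ne : ∀ d, d < 2 * (n - 1) → ∀ i, opp d i ≠ i
  /-- opponents are mutual: the day's games pair up the teams -/
  opp_invol : ∀ d, d < 2 * (n - 1) → ∀ i, opp d (opp d i) = i
  /-- in each game exactly one of the two teams is at home -/
  home_away : ∀ d, d < 2 * (n - 1) → ∀ i, home d (opp d i) = !home d i
  /-- every ordered pair `(i,j)` of distinct teams has exactly one day on which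
  `i` plays away at `j`'s home -/
  plays_once : ∀ i j : Fin n, i ≠ j →
    ∃! d : ℕ, d < 2 * (n - 1) ∧ opp d i = j ∧ home d i = false
  /-- no two teams play against each other on two consecutive days -/
  no_repeat : ∀ d, d + 1 < 2 * (n - 1) → ∀ i, opp (d + 1) i ≠ opp d i
  /-- bounded-by-2: no three consecutive home games and no three consecutive
  away games for any team -/
  bounded_by_two : ∀ d, d + 2 < 2 * (n - 1) → ∀ i,
    ¬(home d i = home (d + 1) i ∧ home (d + 1) i = home (d + 2) i)

/-- The venue of team `i`'s game on day `d`. -/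
def TTP2Schedule.venue {n : ℕ} (s : TTP2Schedule n) (d : ℕ) (i : Fin n) : Fin n :=
  if s.home d i then i else s.opp d i

/-- The travel distance of team `i` (direct traveling): start at home, travel
directly between consecutive venues, and return home after the last game. -/
noncomputable def TTP2Schedule.travel {n : ℕ} (D : Fin n → Fin n → ℝ)
    (s : TTP2Schedule n) (i : Fin n) : ℝ :=
  D i (s.venue 0 i) +
    (∑ d ∈ Finset.range (2 * (n - 1) - 1), D (s.venue d i) (s.venue (d + 1) i)) +
    D (s.venue (2 * (n - 1) - 1) i) i

/-- The total traveling distance of a schedule. -/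
noncomputable def TTP2Schedule.total {n : ℕ} (D : Fin n → Fin n → ℝ)
    (s : TTP2Schedule n) : ℝ :=
  ∑ i, s.travel D i

set_option linter.unusedSimpArgs false
namespace TTP

/-- super-team opponents -/
def P (k : ℕ) (c : ZMod (2*k+1)) : Option (ZMod (2*k+1)) → Option (ZMod (2*k+1))
  | none => some (-c)
  | some u => if u + c = 0 then none else some (-u - 2*c)

/-- role: true when the super-team starts the slot away -/
def rho (k s : ℕ) : Option (ZMod (2*k+1)) → Bool
  | none => decide (s % 2 = 0 ∧ s ≠ 0)
  | some u => if u + (s : ZMod (2*k+1)) = 0 then !decide (s % 2 = 0 ∧ s ≠ 0)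
      else decide (((u + (s : ZMod (2*k+1))).val + s) % 2 = 0)

/-- left super-games -/
def L (k s : ℕ) : Option (ZMod (2*k+1)) → Bool
  | none => decide (0 < s ∧ s < 2*k)
  | some u => decide (u + (s : ZMod (2*k+1)) = 0) && decide (0 < s ∧ s < 2*k)

lemma P_ne {k : ℕ} (c : ZMod (2*k+1)) (u) : P k c u ≠ u := by
  rcases u with _ | u
  · simp [P]
  · simp only [P]
    split_ifs with h
    · simp
    · intro h2
      have h3 : -u - 2*c = u := by simpa using h2
      apply h
      have h4 : (2:ZMod (2*k+1)) * (u+c) = 0 := by linear_combination -h3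
      have h5 : ((2*k+1 : ℕ) : ZMod (2*k+1)) = 0 := ZMod.natCast_self _
      push_cast at h5
      linear_combination (u+c) * h5 - k * h4

lemma P_invol {k : ℕ} (c : ZMod (2*k+1)) (u) : P k c (P k c u) = u := by
  rcases u with _ | u
  · simp [P]
  · simp only [P]
    split_ifs with h
    · simp only [P]; congr 1; linear_combination -h
    · simp only [P]
      have : -u - 2*c + c ≠ 0 := by
        intro h2; apply h; linear_combination -h2
      rw [if_neg this]; congr 1; ring

lemma P_unique {k : ℕ} (u v : Option (ZMod (2*k+1))) (h : u ≠ v) : ∃! c, P k c u = v := by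
  have h5 : ((2*k+1 : ℕ) : ZMod (2*k+1)) = 0 := ZMod.natCast_self _
  push_cast at h5
  rcases u with _ | u <;> rcases v with _ | v
  · exact absurd rfl h
  · refine ⟨-v, by simp [P], ?_⟩
    intro c hc
    simp [P] at hc
    rw [← hc]; ring
  · refine ⟨-u, by simp [P], ?_⟩
    intro c hc
    simp only [P] at hc
    split_ifs at hc with h1
    linear_combination h1
  · have huv : u ≠ v := fun hh => h (by rw [hh])
    refine ⟨-(u+v)*(k+1), ?_, ?_⟩
    · simp only [P]
      have : u + -(u+v)*(k+1) ≠ 0 := by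
        intro h1; apply huv
        linear_combination 2 * h1 + (u+v) * h5
      rw [if_neg this]; congr 1; linear_combination (u+v)*h5
    · intro c hc
      simp only [P] at hc
      split_ifs at hc with h1
      have h3 : -u - 2*c = v := by simpa using hc
      linear_combination -(k+1) * h3 - c * h5

lemma rho_P {k s : ℕ} (u) : rho k s (P k s u) = !rho k s u := by
  rcases u with _ | u
  · simp [P, rho]
  · by_cases h : u + (s : ZMod (2*k+1)) = 0
    · simp [P, rho, h]
    · simp only [P, if_neg h]
      have h2 : -u - 2*(s : ZMod (2*k+1)) + s = -(u + s) := by ring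
      have h3 : -u - 2*(s : ZMod (2*k+1)) + s ≠ 0 := by rw [h2]; exact neg_ne_zero.mpr h
      simp only [rho, if_neg h, if_neg h3]
      rw [h2, ZMod.neg_val, if_neg h]
      have := ZMod.val_lt (u + (s : ZMod (2*k+1)))
      rw [← decide_not]
      apply decide_eq_decide.mpr
      omega

lemma L_P {k s : ℕ} (u) : L k s (P k s u) = L k s u := by
  rcases u with _ | u
  · simp [P, L]
  · by_cases h : u + (s : ZMod (2*k+1)) = 0
    · simp [P, L, h]
    · simp only [P, if_neg h]
      have h2 : -u - 2*(s : ZMod (2*k+1)) + s = -(u + s) := by ring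
      have h3 : -u - 2*(s : ZMod (2*k+1)) + s ≠ 0 := by rw [h2]; exact neg_ne_zero.mpr h
      simp [L, h, h3]

lemma L_last {k : ℕ} (u) : L k (2*k) u = false := by
  rcases u with _ | u <;> simp [L]

lemma val_succ {N : ℕ} [NeZero N] (hN : 1 < N) (x : ZMod N) :
    (x + 1 = 0 ∧ x.val + 1 = N) ∨ (x + 1 ≠ 0 ∧ (x+1).val = x.val + 1) := by
  have h1 : (1 : ZMod N).val = 1 := by
    rw [ZMod.val_one_eq_one_mod, Nat.mod_eq_of_lt hN]
  have h0 := ZMod.val_add x 1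
  rw [h1] at h0
  have hx := ZMod.val_lt x
  rcases Nat.lt_or_ge (x.val+1) N with h | h
  · right
    rw [Nat.mod_eq_of_lt h] at h0
    refine ⟨?_, h0⟩
    intro h2; rw [h2] at h0; simp at h0
  · left
    have : x.val + 1 = N := by omega
    refine ⟨?_, this⟩
    rw [this, Nat.mod_self] at h0
    exact (ZMod.val_eq_zero _).mp h0

/-- consecutive-slot compatibility -/
lemma compat {k s : ℕ} (hk : 1 ≤ k) (hs : s < 2*k) (u) :
    (L k s u = false → rho k (s+1) u = rho k s u) ∧
    (L k s u = true → L k (s+1) u = false → rho k (s+1) u = !rho k s u) := by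
  rcases u with _ | u
  · simp only [L, rho]
    constructor
    · intro h
      simp at h
      apply decide_eq_decide.mpr; omega
    · intro h h'
      simp at h h'
      rw [← decide_not]
      apply decide_eq_decide.mpr; omega
  · have hc : u + ((s+1 : ℕ) : ZMod (2*k+1)) = (u + s) + 1 := by push_cast; ring
    simp only [L, rho, hc]
    generalize u + (s : ZMod (2*k+1)) = x
    have hv := val_succ (N := 2*k+1) (by omega) x
    have hx := ZMod.val_lt x
    by_cases hx0 : x = 0
    · subst hx0
      rcases hv with ⟨h1, h2⟩ | ⟨h1, h2⟩
      · simp at h2; omega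
      · simp only [h1, h2, if_true, if_false]
        simp only [ZMod.val_zero, ← decide_not, decide_true, Bool.true_and, decide_eq_false_iff_not, decide_eq_true_eq, decide_false, Bool.false_and, decide_eq_decide, not_not]
        constructor
        · intro h; omega
        · intro h _; omega
    · rcases hv with ⟨h1, h2⟩ | ⟨h1, h2⟩
      · simp only [h1, hx0, if_true, if_false]
        simp only [ ← decide_not, decide_true, Bool.true_and, decide_eq_false_iff_not, decide_eq_true_eq, decide_false, Bool.false_and, decide_eq_decide, not_not]
        constructor
        · intro h; omega
        · intro h; simp at h
      · simp only [h1, h2, hx0, if_false]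
        simp only [ ← decide_not, decide_true, Bool.true_and, decide_eq_false_iff_not, decide_eq_true_eq, decide_false, Bool.false_and, decide_eq_decide, not_not]
        constructor
        · intro h; omega
        · intro h; simp at h


abbrev U (k : ℕ) := Option (ZMod (2*k+1))

def tint (last : Bool) (r : ℕ) : Bool := last && (r == 1 || r == 5)
def txx (last : Bool) (r : ℕ) : Bool := if last then (r == 2 || r == 4) else r % 2 == 1
def thm (last ρ l b : Bool) (r : ℕ) : Bool :=
  if last then
    (if r = 0 then !ρ else if r = 1 then !b else if r = 2 then b else if r = 3 then ρ
      else if r = 4 then !b else b)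
  else
    (if r = 0 then !ρ else if r = 1 then xor (!ρ) l else if r = 2 then ρ else xor ρ l)
def tlen (last : Bool) : ℕ := if last then 6 else 4

def slot (k d : ℕ) : ℕ := min (d / 4) (2*k)
def isl (k s : ℕ) : Bool := decide (s = 2*k)

def opS (k s r : ℕ) (x : U k × Bool) : U k × Bool :=
  if tint (isl k s) r then (x.1, !x.2) else (P k s x.1, xor x.2 (txx (isl k s) r))
def hmS (k s r : ℕ) (x : U k × Bool) : Bool :=
  thm (isl k s) (rho k s x.1) (L k s x.1) x.2 r

def OP (k d : ℕ) := opS k (slot k d) (d - 4 * slot k d)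
def HM (k d : ℕ) := hmS k (slot k d) (d - 4 * slot k d)

lemma slot_eq {k s r : ℕ} (hs : s ≤ 2*k) (hr : r < tlen (isl k s)) : slot k (4*s+r) = s := by
  unfold slot isl tlen at *
  by_cases h : s = 2*k
  · simp [h] at hr ⊢; omega
  · simp [h] at hr; omega

lemma OP_eq {k s r : ℕ} (hs : s ≤ 2*k) (hr : r < tlen (isl k s)) : OP k (4*s+r) = opS k s r := by
  unfold OP; rw [slot_eq hs hr]; congr 1; omega

lemma HM_eq {k s r : ℕ} (hs : s ≤ 2*k) (hr : r < tlen (isl k s)) : HM k (4*s+r) = hmS k s r := by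
  unfold HM; rw [slot_eq hs hr]; congr 1; omega

lemma day_cases {k d : ℕ} (hd : d < 8*k+6) :
    ∃ s r, s ≤ 2*k ∧ r < tlen (isl k s) ∧ d = 4*s+r := by
  refine ⟨slot k d, d - 4 * slot k d, ?_, ?_, ?_⟩
  · unfold slot; omega
  · unfold slot isl tlen
    by_cases h : min (d/4) (2*k) = 2*k
    · simp [h]; omega
    · simp [h]; omega
  · unfold slot; omega

lemma opS_ne {k s r : ℕ} (x) : opS k s r x ≠ x := by
  unfold opS
  split_ifs
  · intro h; have := congrArg Prod.snd h; simp at this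
  · intro h; exact P_ne _ _ (congrArg Prod.fst h)

lemma opS_invol {k s r : ℕ} (x) : opS k s r (opS k s r x) = x := by
  unfold opS
  split_ifs
  · simp
  · simp [P_invol]

lemma thm_int : ∀ last ρ l b : Bool, ∀ r < 6, tint last r = true →
    thm last ρ l (!b) r = !thm last ρ l b r := by decide
lemma thm_cross : ∀ last ρ l b : Bool, ∀ r < 6, tint last r = false →
    thm last (!ρ) l (xor b (txx last r)) r = !thm last ρ l b r := by decide

lemma tlen_le (last) : tlen last ≤ 6 := by cases last <;> decide

lemma hmS_op {k s r : ℕ} (hr : r < tlen (isl k s)) (x) : hmS k s r (opS k s r x) = !hmS k s r x := by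
  have hr6 : r < 6 := lt_of_lt_of_le hr (tlen_le _)
  unfold opS hmS
  split_ifs with h
  · exact thm_int _ _ _ _ _ hr6 h
  · simp only [rho_P, L_P]
    exact thm_cross _ _ _ _ _ hr6 (by simpa using h)

lemma once_int : ∀ b ρ l : Bool, ∃ r < 6, (tint true r = true ∧ thm true ρ l b r = false) ∧
    ∀ r' < 6, (tint true r' = true ∧ thm true ρ l b r' = false) → r' = r := by decide
lemma once_cross : ∀ last b ρ l x : Bool, ∃ r < tlen last,
    (tint last r = false ∧ txx last r = x ∧ thm last ρ l b r = false) ∧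
    ∀ r' < tlen last, (tint last r' = false ∧ txx last r' = x ∧ thm last ρ l b r' = false) → r' = r := by
  decide

lemma tint_isl {k s r} (h : tint (isl k s) r = true) : s = 2*k := by
  unfold tint isl at h; simp at h; exact h.1

lemma once {k : ℕ} (x y : U k × Bool) (h : x ≠ y) :
    ∃! d : ℕ, d < 8*k+6 ∧ OP k d x = y ∧ HM k d x = false := by
  obtain ⟨u, b⟩ := x
  obtain ⟨v, c⟩ := y
  by_cases huv : u = v
  · subst huv
    have hc : c = !b := by
      cases b <;> cases c <;> simp_all
    subst hc
    obtain ⟨r, hr, ⟨h1, h2⟩, h3⟩ := once_int b (rho k (2*k) u) (L k (2*k) u)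
    have hl : isl k (2*k) = true := by simp [isl]
    have hr' : r < tlen (isl k (2*k)) := by rw [hl]; exact hr
    refine ⟨4*(2*k)+r, ⟨by omega, ?_, ?_⟩, ?_⟩
    · rw [OP_eq le_rfl hr']; simp [opS, hl, h1]
    · rw [HM_eq le_rfl hr']; simp only [hmS, hl, h2]
    · rintro d ⟨hd, ho, hh⟩
      obtain ⟨s, r', hs, hr2, rfl⟩ := day_cases hd
      rw [OP_eq hs hr2] at ho
      rw [HM_eq hs hr2] at hh
      by_cases ht : tint (isl k s) r' = true
      · have hs2 := tint_isl ht
        subst hs2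
        rw [hl] at hr2 ht
        simp only [hmS, hl] at hh
        rw [h3 r' hr2 ⟨ht, hh⟩]
      · simp only [opS, ht] at ho
        exact absurd (congrArg Prod.fst ho) (P_ne _ _)
  · obtain ⟨c0, hc0, hcu⟩ := P_unique u v huv
    have hc1 : c0.val ≤ 2*k := by have := ZMod.val_lt c0; omega
    have hc2 : ((c0.val : ℕ) : ZMod (2*k+1)) = c0 := ZMod.natCast_zmod_val c0
    obtain ⟨r, hr, ⟨h1, h2, h2'⟩, h3⟩ :=
      once_cross (isl k c0.val) b (rho k c0.val u) (L k c0.val u) (xor b c)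
    refine ⟨4*c0.val+r, ⟨?_, ?_, ?_⟩, ?_⟩
    · have := tlen_le (isl k c0.val)
      by_cases h0 : c0.val = 2*k
      · omega
      · simp [isl, h0, tlen] at hr; omega
    · rw [OP_eq hc1 hr]; simp [opS, h1, h2, hc2, hc0]
    · rw [HM_eq hc1 hr]; simp only [hmS, h2']
    · rintro d ⟨hd, ho, hh⟩
      obtain ⟨s, r', hs, hr2, rfl⟩ := day_cases hd
      rw [OP_eq hs hr2] at ho
      rw [HM_eq hs hr2] at hh
      by_cases ht : tint (isl k s) r' = true
      · simp only [opS, ht] at ho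
        exact absurd (congrArg Prod.fst ho) huv
      · simp only [opS, ht] at ho
        have e1 : P k (s : ZMod (2*k+1)) u = v := congrArg Prod.fst ho
        have e2 : xor b (txx (isl k s) r') = c := congrArg Prod.snd ho
        have e3 := hcu _ e1
        have e4 : s = c0.val := by
          rw [← e3, ZMod.val_cast_of_lt (by omega)]
        subst e4
        rw [h3 r' hr2 ⟨by simpa using ht, by rw [← e2]; simp, hh⟩]

lemma rep_aux : ∀ last : Bool, ∀ r, r + 1 < tlen last → 
    (tint last r = false ∨ tint last (r+1) = false) ∧
    (tint last r = false → tint last (r+1) = false → txx last r ≠ txx last (r+1)) := by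
  intro last r hr
  have : r < 6 := by have := tlen_le last; omega
  revert hr
  revert last
  interval_cases r <;> decide

lemma no_rep {k : ℕ} (d : ℕ) (hd : d + 1 < 8*k+6) (x : U k × Bool) : OP k (d+1) x ≠ OP k d x := by
  obtain ⟨s, r, hs, hr, rfl⟩ := day_cases (show d < 8*k+6 by omega)
  rw [OP_eq hs hr]
  by_cases h : r + 1 < tlen (isl k s)
  · rw [add_assoc, OP_eq hs h]
    obtain ⟨h1, h2⟩ := rep_aux _ _ h
    unfold opS
    split_ifs with a1 a2 a2
    · simp_all
    · intro e; exact P_ne _ _ (congrArg Prod.fst e).symm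
    · intro e; exact P_ne _ _ (congrArg Prod.fst e)
    · intro e
      have := congrArg Prod.snd e
      simp only [Bool.xor_right_inj] at this
      exact h2 (by simpa using a2) (by simpa using a1) this.symm
  · have hl : s < 2*k := by
      by_contra h0
      have : s = 2*k := by omega
      subst this
      simp [isl, tlen] at h hr
      omega
    have hil : isl k s = false := by simp [isl]; omega
    rw [hil] at h hr
    have hr3 : r = 3 := by simp [tlen] at h hr; omega
    subst hr3
    rw [show 4*s+3+1 = 4*(s+1)+0 by ring, OP_eq (by omega) (by unfold tlen; split_ifs <;> omega)]
    have t1 : tint (isl k (s+1)) 0 = false := by simp [tint]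
    have t2 : tint (isl k s) 3 = false := by simp [tint]
    simp only [opS, t1, t2]
    intro e
    have e1 : P k ((s+1 : ℕ) : ZMod (2*k+1)) x.1 = P k (s : ZMod (2*k+1)) x.1 := congrArg Prod.fst e
    have e2 := (P_unique x.1 (P k (s : ZMod (2*k+1)) x.1) (P_ne _ _).symm).unique e1 rfl
    have e3 := congrArg ZMod.val e2
    rw [ZMod.val_cast_of_lt (by omega), ZMod.val_cast_of_lt (by omega)] at e3
    omega

lemma bd_in : ∀ r < 4, ∀ last ρ l b : Bool, r + 2 < tlen last →
    ¬ (thm last ρ l b r = thm last ρ l b (r+1) ∧ thm last ρ l b (r+1) = thm last ρ l b (r+2)) := by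
  decide
lemma bd_2 : ∀ last' ρ l b ρ' l' : Bool, (l = false → ρ' = ρ) →
    (l = true → l' = false → ρ' = !ρ) → 
    ¬ (thm false ρ l b 2 = thm false ρ l b 3 ∧ thm false ρ l b 3 = thm last' ρ' l' b 0) := by
  decide
lemma bd_3 : ∀ last' ρ l b ρ' l' : Bool, (last' = true → l' = false) → (l = false → ρ' = ρ) →
    (l = true → l' = false → ρ' = !ρ) → 
    ¬ (thm false ρ l b 3 = thm last' ρ' l' b 0 ∧ thm last' ρ' l' b 0 = thm last' ρ' l' b 1) := by
  decide

lemma bdd {k : ℕ} (hk : 1 ≤ k) (d : ℕ) (hd : d + 2 < 8*k+6) (x : U k × Bool) :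
    ¬ (HM k d x = HM k (d+1) x ∧ HM k (d+1) x = HM k (d+2) x) := by
  obtain ⟨s, r, hs, hr, rfl⟩ := day_cases (show d < 8*k+6 by omega)
  rw [HM_eq hs hr]
  by_cases h : r + 2 < tlen (isl k s)
  · rw [add_assoc, add_assoc, HM_eq hs (by omega), HM_eq hs h]
    exact bd_in r (by have := tlen_le (isl k s); omega) _ _ _ _ h
  · have hl : s < 2*k := by
      by_contra h0
      have : s = 2*k := by omega
      subst this
      simp [isl, tlen] at h hr
      omega
    have hil : isl k s = false := by simp [isl]; omega
    have hr' := hr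
    rw [hil] at h hr'
    have hr3 : r = 2 ∨ r = 3 := by simp [tlen] at h hr'; omega
    obtain ⟨c1, c2⟩ := compat hk hl x.1
    have p0 : 0 < tlen (isl k (s+1)) := by unfold tlen; split_ifs <;> omega
    have p1 : 1 < tlen (isl k (s+1)) := by unfold tlen; split_ifs <;> omega
    have p3 : 3 < tlen (isl k s) := by rw [hil]; decide
    rcases hr3 with rfl | rfl
    · rw [show 4*s+2+1 = 4*s+3 by ring, show 4*s+2+2 = 4*(s+1)+0 by ring, HM_eq hs p3,
        HM_eq (by omega) p0]
      simp only [hmS, hil]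
      exact bd_2 _ _ _ _ _ _ c1 c2
    · rw [show 4*s+3+1 = 4*(s+1)+0 by ring, show 4*s+3+2 = 4*(s+1)+1 by ring, 
        HM_eq (by omega) p0, HM_eq (by omega) p1]
      simp only [hmS, hil]
      refine bd_3 _ _ _ _ _ _ ?_ c1 c2
      intro hh
      have : s + 1 = 2*k := by simpa [isl] using hh
      rw [this]; exact L_last _

/-- the schedule -/
def sched {k n : ℕ} (hk : 1 ≤ k) (hn : n = 4*k+4) (e : U k × Bool ≃ Fin n) : TTP2Schedule n where
  opp d i := e (OP k d (e.symm i))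
  home d i := HM k d (e.symm i)
  opp_ne d hd i := by
    obtain ⟨s, r, hs, hr, rfl⟩ := day_cases (show d < 8*k+6 by omega)
    rw [OP_eq hs hr]
    intro h
    exact opS_ne _ (e.injective (h.trans (e.apply_symm_apply i).symm))
  opp_invol d hd i := by
    obtain ⟨s, r, hs, hr, rfl⟩ := day_cases (show d < 8*k+6 by omega)
    rw [OP_eq hs hr]
    simp [opS_invol]
  home_away d hd i := by
    obtain ⟨s, r, hs, hr, rfl⟩ := day_cases (show d < 8*k+6 by omega)
    rw [OP_eq hs hr, HM_eq hs hr]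
    simp [hmS_op hr]
  plays_once i j hij := by
    have := once (e.symm i) (e.symm j) (by simpa using hij)
    rw [show 2 * (n-1) = 8*k+6 by omega]
    simpa [Equiv.eq_symm_apply] using this
  no_repeat d hd i h := no_rep d (by omega) _ (e.injective h)
  bounded_by_two d hd i := bdd hk d (by omega) _


structure IsM {T : Type} (Δ : T → T → ℝ) : Prop where
  z : ∀ x, Δ x x = 0
  s : ∀ x y, Δ x y = Δ y x
  p : ∀ x y, 0 ≤ Δ x y
  t : ∀ x y z, Δ x z ≤ Δ x y + Δ y z

def VS (k s r : ℕ) (x : U k × Bool) : U k × Bool := if hmS k s r x then x else opS k s r x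
def VV (k d : ℕ) (x : U k × Bool) : U k × Bool := if HM k d x then x else OP k d x

lemma VV_eq {k s r : ℕ} (hs : s ≤ 2*k) (hr : r < tlen (isl k s)) (x) :
    VV k (4*s+r) x = VS k s r x := by
  unfold VV VS; rw [OP_eq hs hr, HM_eq hs hr]

lemma venue_eq {k n : ℕ} (hk : 1 ≤ k) (hn : n = 4*k+4) (e : U k × Bool ≃ Fin n) (d) (x) :
    (sched hk hn e).venue d (e x) = e (VV k d x) := by
  unfold TTP2Schedule.venue VV
  simp only [sched, Equiv.symm_apply_apply]
  split_ifs <;> rfl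

def cst (k s : ℕ) (u : U k) : Bool := (L k s u || isl k s) && rho k s u

noncomputable def ex {k : ℕ} (Δ : U k × Bool → U k × Bool → ℝ) (x : U k × Bool) (v : U k) : ℝ :=
  Δ x (v, x.2) + Δ x (v, !x.2)
noncomputable def bs {k : ℕ} (Δ : U k × Bool → U k × Bool → ℝ) (x : U k × Bool) (v : U k) : ℝ :=
  ex Δ x v + Δ (v, x.2) (v, !x.2)

noncomputable def loop4 {k : ℕ} (Δ : U k × Bool → U k × Bool → ℝ) (s : ℕ) (x : U k × Bool) : ℝ :=
  Δ x (VS k s 0 x) + Δ (VS k s 0 x) (VS k s 1 x) + Δ (VS k s 1 x) (VS k s 2 x)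
    + Δ (VS k s 2 x) (VS k s 3 x) + Δ (VS k s 3 x) x
noncomputable def loop6 {k : ℕ} (Δ : U k × Bool → U k × Bool → ℝ) (s : ℕ) (x : U k × Bool) : ℝ :=
  Δ x (VS k s 0 x) + Δ (VS k s 0 x) (VS k s 1 x) + Δ (VS k s 1 x) (VS k s 2 x)
    + Δ (VS k s 2 x) (VS k s 3 x) + Δ (VS k s 3 x) (VS k s 4 x)
    + Δ (VS k s 4 x) (VS k s 5 x) + Δ (VS k s 5 x) x

lemma loop4_le {k : ℕ} {Δ : U k × Bool → U k × Bool → ℝ} (h : IsM Δ) {s : ℕ} (hs : s < 2*k)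
    (x : U k × Bool) :
    loop4 Δ s x ≤ bs Δ x (P k s x.1) + if cst k s x.1 then ex Δ x (P k s x.1) else 0 := by
  obtain ⟨u, b⟩ := x
  have hil : isl k s = false := by simp [isl]; omega
  have a1 := h.z (u, b)
  have a2 := h.s (u, b) (P k s u, b)
  have a3 := h.s (u, b) (P k s u, !b)
  have a4 := h.s (P k s u, b) (P k s u, !b)
  have a5 := h.p (P k s u, b) (P k s u, !b)
  unfold loop4 bs ex cst VS hmS opS
  rw [hil]
  cases rho k s u <;> cases L k s u <;> simp [tint, txx, thm, a1] <;> linarith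

lemma loop6_le {k : ℕ} {Δ : U k × Bool → U k × Bool → ℝ} (h : IsM Δ) 
    (x : U k × Bool) :
    loop6 Δ (2*k) x ≤ bs Δ x (P k (2*k : ℕ) x.1) + 2 * Δ x (x.1, !x.2)
      + if cst k (2*k) x.1 then ex Δ x (P k (2*k : ℕ) x.1) else 0 := by
  obtain ⟨u, b⟩ := x
  have hil : isl k (2*k) = true := by simp [isl]
  unfold loop6 bs ex cst VS hmS opS
  rw [hil, L_last]
  simp only []
  generalize P k ((2*k : ℕ) : ZMod (2*k+1)) u = v
  have a1 := h.z (u, b)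
  have a2 := h.s (u, b) (v, b)
  have a3 := h.s (u, b) (v, !b)
  have a4 := h.s (v, b) (v, !b)
  have a5 := h.p (v, b) (v, !b)
  have a6 := h.s (u, b) (u, !b)
  have a7 := h.s (u, !b) (v, b)
  have a8 := h.s (u, !b) (v, !b)
  have a9 := h.p (u, b) (u, !b)
  have b1 := h.t (u, !b) (u, b) (v, b)
  have b2 := h.t (u, !b) (u, b) (v, !b)
  cases rho k (2*k) u <;> cases b <;> simp [tint, txx, thm, a1] at * <;> linarith

lemma tour_le {T : Type} {Δ : T → T → ℝ} (h : IsM Δ) (x : T) (V : ℕ → T) (j : ℕ) :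
    Δ x (V 0) + ∑ d ∈ Finset.range (4*j+3), Δ (V d) (V (d+1)) + Δ (V (4*j+3)) x ≤
    ∑ s ∈ Finset.range (j+1), (Δ x (V (4*s)) + Δ (V (4*s)) (V (4*s+1))
      + Δ (V (4*s+1)) (V (4*s+2)) + Δ (V (4*s+2)) (V (4*s+3)) + Δ (V (4*s+3)) x) := by
  induction j with
  | zero => simp [Finset.sum_range_succ]; linarith
  | succ j ih =>
    rw [Finset.sum_range_succ _ (j+1)]
    rw [show 4*(j+1)+3 = 4*j+3+1+1+1+1 by ring]
    simp only [Finset.sum_range_succ _ (4*j+3+1+1+1), Finset.sum_range_succ _ (4*j+3+1+1),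
      Finset.sum_range_succ _ (4*j+3+1), Finset.sum_range_succ _ (4*j+3)]
    have := h.t (V (4*j+3)) x (V (4*j+4))
    simp only [show 4*(j+1) = 4*j+4 by ring, add_assoc, Nat.reduceAdd] at *
    linarith

lemma tour6_le {T : Type} {Δ : T → T → ℝ} (h : IsM Δ) (x : T) (V : ℕ → T) (k : ℕ) (hk : 1 ≤ k) :
    Δ x (V 0) + ∑ d ∈ Finset.range (8*k+5), Δ (V d) (V (d+1)) + Δ (V (8*k+5)) x ≤
    ∑ s ∈ Finset.range (2*k), (Δ x (V (4*s)) + Δ (V (4*s)) (V (4*s+1))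
      + Δ (V (4*s+1)) (V (4*s+2)) + Δ (V (4*s+2)) (V (4*s+3)) + Δ (V (4*s+3)) x)
    + (Δ x (V (4*(2*k))) + Δ (V (4*(2*k))) (V (4*(2*k)+1)) + Δ (V (4*(2*k)+1)) (V (4*(2*k)+2))
      + Δ (V (4*(2*k)+2)) (V (4*(2*k)+3)) + Δ (V (4*(2*k)+3)) (V (4*(2*k)+4))
      + Δ (V (4*(2*k)+4)) (V (4*(2*k)+5)) + Δ (V (4*(2*k)+5)) x) := by
  obtain ⟨j, hj⟩ : ∃ j, 2*k = j+1 := ⟨2*k-1, by omega⟩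
  have ih := tour_le h x V j
  rw [show 8*k+5 = 4*j+3+1+1+1+1+1+1 by omega, hj]
  simp only [Finset.sum_range_succ _ (4*j+3+1+1+1), Finset.sum_range_succ _ (4*j+3+1+1),
      Finset.sum_range_succ _ (4*j+3+1), Finset.sum_range_succ _ (4*j+3),
      Finset.sum_range_succ _ (4*j+3+1+1+1+1), Finset.sum_range_succ _ (4*j+3+1+1+1+1+1)]
  have := h.t (V (4*j+3)) x (V (4*j+4))
  simp only [show 4*(j+1) = 4*j+4 by ring, add_assoc, Nat.reduceAdd] at *
  linarith

lemma travel_le {k n : ℕ} (hk : 1 ≤ k) (hn : n = 4*k+4) (e : U k × Bool ≃ Fin n)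
    (D : Fin n → Fin n → ℝ) (h : IsM (fun x y => D (e x) (e y))) (x : U k × Bool) :
    (sched hk hn e).travel D (e x) ≤
      ∑ s ∈ Finset.range (2*k+1), (bs (fun x y => D (e x) (e y)) x (P k s x.1)
        + if cst k s x.1 then ex (fun x y => D (e x) (e y)) x (P k s x.1) else 0)
      + 2 * D (e x) (e (x.1, !x.2)) := by
  unfold TTP2Schedule.travel
  simp only [venue_eq]
  rw [show 2*(n-1)-1 = 8*k+5 by omega]
  refine (tour6_le h x (fun d => VV k d x) k hk).trans ?_
  rw [Finset.sum_range_succ]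
  have h6 := loop6_le h x
  have : ∀ s ∈ Finset.range (2*k), _ := fun s hs => loop4_le h (Finset.mem_range.mp hs) x
  have h4 := Finset.sum_le_sum this
  have e6 : ∀ r < 6, VV k (4*(2*k)+r) x = VS k (2*k) r x := fun r hr =>
    VV_eq le_rfl (by simp [isl, tlen, hr]) x
  have e60 := e6 0 (by omega)
  rw [add_zero] at e60
  simp only [e6 1 (by omega), e6 2 (by omega), e6 3 (by omega), e6 4 (by omega), e6 5 (by omega), e60]
  have e4 : ∀ s ∈ Finset.range (2*k), (D (e x) (e (VV k (4*s) x)) + D (e (VV k (4*s) x)) (e (VV k (4*s+1) x))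
      + D (e (VV k (4*s+1) x)) (e (VV k (4*s+2) x)) + D (e (VV k (4*s+2) x)) (e (VV k (4*s+3) x))
      + D (e (VV k (4*s+3) x)) (e x)) = loop4 (fun x y => D (e x) (e y)) s x := by
    intro s hs
    have hs := Finset.mem_range.mp hs
    have e5 : ∀ r < 4, VV k (4*s+r) x = VS k s r x := fun r hr =>
      VV_eq hs.le (by have := tlen_le (isl k s); unfold tlen; split_ifs <;> omega) x
    have e50 := e5 0 (by omega)
    rw [add_zero] at e50
    rw [e5 1 (by omega), e5 2 (by omega), e5 3 (by omega), e50]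
    rfl
  rw [Finset.sum_congr rfl e4]
  unfold loop6 at h6
  linarith

lemma sum_P {k : ℕ} (u : U k) (g : U k → ℝ) :
    ∑ s ∈ Finset.range (2*k+1), g (P k s u) = ∑ v, g v - g u := by
  rw [← Finset.sum_erase_add Finset.univ g (Finset.mem_univ u), add_sub_cancel_right]
  refine Finset.sum_bij (fun s _ => P k (s : ZMod (2*k+1)) u) ?_ ?_ ?_ ?_
  · intro s _; simp [P_ne]
  · intro s hs s' hs' hh
    have e2 := (P_unique u (P k (s : ZMod (2*k+1)) u) (P_ne _ _).symm).unique rfl hh.symm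
    have e3 := congrArg ZMod.val e2
    rw [Finset.mem_range] at hs hs'
    rwa [ZMod.val_cast_of_lt (by omega), ZMod.val_cast_of_lt (by omega)] at e3
  · intro v hv
    have hv : v ≠ u := by simpa using hv
    obtain ⟨c, hc, -⟩ := P_unique u v hv.symm
    refine ⟨c.val, by simpa using ZMod.val_lt c, ?_⟩
    rw [ZMod.natCast_zmod_val]; exact hc
  · intros; rfl

noncomputable def ww {k : ℕ} (Δ : U k × Bool → U k × Bool → ℝ) (u v : U k) : ℝ :=
  ex Δ (u, false) v + ex Δ (u, true) v

lemma total_le {k n : ℕ} (hk : 1 ≤ k) (hn : n = 4*k+4) (e : U k × Bool ≃ Fin n)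
    (D : Fin n → Fin n → ℝ) (h : IsM (fun x y => D (e x) (e y))) (M : Fin n → Fin n)
    (he : ∀ u b, M (e (u, b)) = e (u, !b)) :
    (sched hk hn e).total D ≤ 2 * sumPairs D + n * pmWeight D M +
      ∑ s ∈ Finset.range (2*k+1), ∑ u, 
        if cst k s u then ww (fun x y => D (e x) (e y)) u (P k s u) else 0 := by
  set Δ : U k × Bool → U k × Bool → ℝ := fun x y => D (e x) (e y) with hΔ
  have hS : 2 * sumPairs D = ∑ u, ∑ v, ww Δ u v := by
    unfold sumPairs
    rw [mul_div_cancel₀ _ (two_ne_zero)]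
    have h1 : ∀ i, ∑ j ∈ Finset.univ \ {i}, D i j = ∑ j, D i j := by
      intro i
      rw [← Finset.erase_eq]
      apply Finset.sum_erase
      have := h.z (e.symm i)
      simpa [hΔ] using this
    simp only [h1]
    rw [← e.sum_comp]
    simp only [← e.sum_comp (fun j => D _ j)]
    rw [Fintype.sum_prod_type]
    refine Finset.sum_congr rfl fun u _ => ?_
    simp only [Fintype.sum_prod_type, Fintype.sum_bool, ← Finset.sum_add_distrib]
    refine Finset.sum_congr rfl fun v _ => ?_
    simp only [ww, ex, hΔ, Bool.not_false, Bool.not_true]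
    ring
  have hP : pmWeight D M = ∑ u, Δ (u, false) (u, true) := by
    unfold pmWeight
    rw [← e.sum_comp, Fintype.sum_prod_type, Finset.sum_div]
    refine Finset.sum_congr rfl fun u _ => ?_
    have := h.s (u, false) (u, true)
    simp only [Fintype.sum_bool, he, Bool.not_false, Bool.not_true]
    simp only [hΔ] at *
    linarith
  have hT : (sched hk hn e).total D ≤ ∑ x : U k × Bool, (∑ s ∈ Finset.range (2*k+1), (bs Δ x (P k s x.1)
        + if cst k s x.1 then ex Δ x (P k s x.1) else 0) + 2 * Δ x (x.1, !x.2)) := by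
    unfold TTP2Schedule.total
    rw [← e.sum_comp]
    exact Finset.sum_le_sum fun x _ => travel_le hk hn e D h x
  refine hT.trans (le_of_eq ?_)
  rw [Finset.sum_comm (s := Finset.range (2*k+1)), hS, hP, Fintype.sum_prod_type, Finset.mul_sum]
  have key : ∀ u : U k, ∑ b : Bool, (∑ s ∈ Finset.range (2*k+1), (bs Δ (u, b) (P k s u)
        + if cst k s u then ex Δ (u, b) (P k s u) else 0) + 2 * Δ (u, b) (u, !b)) =
      ∑ v, ww Δ u v + 2 * ∑ v, Δ (v, false) (v, true) + 
       ∑ s ∈ Finset.range (2*k+1), (if cst k s u then ww Δ u (P k s u) else 0) := by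
    intro u
    have a0 := h.z (u, false)
    have a1 := h.z (u, true)
    have a2 := h.s (u, false) (u, true)
    have a3 : ∑ v, Δ (v, true) (v, false) = ∑ v, Δ (v, false) (v, true) :=
      Finset.sum_congr rfl fun v _ => h.s _ _
    simp only [Fintype.sum_bool, Finset.sum_add_distrib, sum_P]
    have a4 : ∑ s ∈ Finset.range (2*k+1), (if cst k s u then ww Δ u (P k s u) else 0) =
       ∑ s ∈ Finset.range (2*k+1), (if cst k s u then ex Δ (u, true) (P k s u) else 0) +
       ∑ s ∈ Finset.range (2*k+1), (if cst k s u then ex Δ (u, false) (P k s u) else 0) := by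
      rw [← Finset.sum_add_distrib]
      refine Finset.sum_congr rfl fun s _ => ?_
      split_ifs
      · unfold ww; ring
      · ring
    rw [a4]
    simp only [ww, bs, ex, Finset.sum_add_distrib, Bool.not_false, Bool.not_true]
    rw [a3, a0, a1]
    linarith
  rw [Finset.sum_congr rfl fun u _ => key u]
  simp only [Finset.sum_add_distrib, Finset.sum_const, Finset.card_univ, Fintype.card_option, ZMod.card, nsmul_eq_mul,
    ← Finset.mul_sum]
  rw [hn]; push_cast; ring


lemma exists_perm {V : Type} [DecidableEq V] {u v u' v' : V} (h : u ≠ v) (h' : u' ≠ v') :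
    ∃ τ : Equiv.Perm V, τ u = u' ∧ τ v = v' := by
  refine ⟨(Equiv.swap u u').trans (Equiv.swap (Equiv.swap u u' v) v'), ?_, ?_⟩
  · simp only [Equiv.trans_apply, Equiv.swap_apply_left]
    apply Equiv.swap_apply_of_ne_of_ne _ h'
    intro h2
    have : Equiv.swap u u' u = Equiv.swap u u' v := by rw [Equiv.swap_apply_left]; exact h2
    exact h ((Equiv.swap u u').injective this)
  · simp

lemma perm_avg {V : Type} [DecidableEq V] [Fintype V] (f : V → V → ℝ) {u v : V} (h : u ≠ v) :
    (Fintype.card V : ℝ) * (Fintype.card V - 1) * ∑ σ : Equiv.Perm V, f (σ u) (σ v) =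
      Fintype.card (Equiv.Perm V) * (∑ x, ∑ y, f x y - ∑ x, f x x) := by
  have key : ∀ u' v', u' ≠ v' → ∑ σ : Equiv.Perm V, f (σ u') (σ v') =
      ∑ σ : Equiv.Perm V, f (σ u) (σ v) := by
    intro u' v' h'
    obtain ⟨τ, h1, h2⟩ := exists_perm h h'
    rw [← Equiv.sum_comp (Equiv.mulRight τ) (fun σ : Equiv.Perm V => f (σ u) (σ v))]
    simp [h1, h2]
  have e1 : ∑ x, ∑ y ∈ Finset.univ.erase x, ∑ σ : Equiv.Perm V, f (σ x) (σ y) =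
      (Fintype.card V : ℝ) * (Fintype.card V - 1) * ∑ σ : Equiv.Perm V, f (σ u) (σ v) := by
    have : ∀ x, ∑ y ∈ Finset.univ.erase x, ∑ σ : Equiv.Perm V, f (σ x) (σ y) =
        ((Fintype.card V : ℝ) - 1) * ∑ σ : Equiv.Perm V, f (σ u) (σ v) := by
      intro x
      rw [Finset.sum_congr rfl (fun y hy => key x y (Finset.ne_of_mem_erase hy).symm)]
      rw [Finset.sum_const, Finset.card_erase_of_mem (Finset.mem_univ _), nsmul_eq_mul,
        Finset.card_univ, Nat.cast_sub (Fintype.card_pos_iff.mpr ⟨x⟩), Nat.cast_one]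
    simp only [this]
    rw [Finset.sum_const, nsmul_eq_mul, Finset.card_univ, mul_assoc]
  rw [← e1]
  have e2 : ∀ x, ∑ y ∈ Finset.univ.erase x, ∑ σ : Equiv.Perm V, f (σ x) (σ y) =
      ∑ σ : Equiv.Perm V, (∑ y, f (σ x) y - f (σ x) (σ x)) := by
    intro x
    rw [Finset.sum_comm]
    refine Finset.sum_congr rfl fun σ _ => ?_
    rw [Finset.sum_erase_eq_sub (Finset.mem_univ x), Equiv.sum_comp σ (fun y => f (σ x) y)]
  simp only [e2]
  rw [Finset.sum_comm]
  have e3 : ∀ σ : Equiv.Perm V, ∑ x, (∑ y, f (σ x) y - f (σ x) (σ x)) = 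
      ∑ x, ∑ y, f x y - ∑ x, f x x := by
    intro σ
    rw [Equiv.sum_comp σ (fun x => ∑ y, f x y - f x x), Finset.sum_sub_distrib]
  simp only [e3]
  rw [Finset.sum_const, nsmul_eq_mul, Finset.card_univ]

/-- twice the number of costly super-teams in a slot -/
lemma count_slot {k s : ℕ} : 2 * ∑ u : U k, (if cst k s u then (1:ℝ) else 0) =
    ∑ u : U k, (if (L k s u || isl k s) then (1:ℝ) else 0) := by
  let E : Equiv.Perm (U k) := ⟨P k s, P k s, P_invol _, P_invol _⟩
  have h := Equiv.sum_comp E (fun u => if cst k s u then (1:ℝ) else 0)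
  rw [two_mul]
  nth_rewrite 1 [← h]
  rw [← Finset.sum_add_distrib]
  refine Finset.sum_congr rfl fun u _ => ?_
  simp only [E, Equiv.coe_fn_mk, cst, L_P, rho_P]
  by_cases h1 : L k s u = true <;> by_cases h2 : isl k s = true <;>
    by_cases h3 : rho k s u = true <;> simp [h1, h2, h3]

lemma count_le {k : ℕ} (hk : 1 ≤ k) :
    ∑ s ∈ Finset.range (2*k+1), ∑ u : U k, (if cst k s u then (1:ℝ) else 0) ≤ 3*k := by
  have h0 : ∑ u : U k, (if cst k 0 u then (1:ℝ) else 0) = 0 := by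
    apply Finset.sum_eq_zero
    intro u _
    have : isl k 0 = false := by simp [isl]; omega
    have h2 : L k 0 u = false := by rcases u with _ | u <;> simp [L]
    simp [cst, this, h2]
  have hl : ∑ u : U k, (if cst k (2*k) u then (1:ℝ) else 0) = k + 1 := by
    have := @count_slot k (2*k)
    simp only [show isl k (2*k) = true by simp [isl], Bool.or_true, if_true, Finset.sum_const,
      Finset.card_univ, Fintype.card_option, ZMod.card, nsmul_eq_mul] at this
    push_cast at this
    linarith
  have hm : ∀ s ∈ Finset.range (2*k-1), ∑ u : U k, (if cst k (s+1) u then (1:ℝ) else 0) = 1 := by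
    intro s hs
    have hs := Finset.mem_range.mp hs
    have := @count_slot k (s+1)
    rw [show isl k (s+1) = false by simp [isl]; omega] at this
    have h3 : ∑ u : U k, (if (L k (s+1) u || false) then (1:ℝ) else 0) = 2 := by
      rw [Fintype.sum_option]
      have hd : decide (0 < s+1 ∧ s+1 < 2*k) = true := by simp; omega
      simp only [L, hd, Bool.or_false, Bool.and_true, if_true]
      have : ∀ u : ZMod (2*k+1), (if (decide (u + ((s+1 : ℕ) : ZMod (2*k+1)) = 0)) = true then (1:ℝ) else 0) =
          if u = -((s+1 : ℕ) : ZMod (2*k+1)) then 1 else 0 := by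
        intro u
        simp only [decide_eq_true_eq, eq_neg_iff_add_eq_zero]
      simp only [this]
      rw [Finset.sum_ite_eq' Finset.univ]
      simp; norm_num
    rw [h3] at this
    linarith
  rw [Finset.sum_range_succ, hl]
  obtain ⟨j, hj⟩ : ∃ j, 2*k = j+1 := ⟨2*k-1, by omega⟩
  rw [show 2*k-1 = j by omega] at hm
  rw [show Finset.range (2*k) = Finset.range (j+1) by rw [hj], Finset.sum_range_succ', h0,
    Finset.sum_congr rfl hm]
  simp only [Finset.sum_const, Finset.card_range, nsmul_eq_mul]
  have : (2*k : ℝ) = j + 1 := by exact_mod_cast hj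
  linarith

lemma exists_equiv {k n : ℕ} (hn : n = 4*k+4) (M : Fin n → Fin n) (hM : IsPM M) :
    ∃ e : U k × Bool ≃ Fin n, ∀ u b, M (e (u, b)) = e (u, !b) := by
  obtain ⟨hi, hne⟩ := hM
  let A := {i : Fin n // i < M i}
  let f : A × Bool → Fin n := fun x => if x.2 then M x.1.1 else x.1.1
  have hf : Function.Bijective f := by
    constructor
    · rintro ⟨⟨a, ha⟩, b⟩ ⟨⟨a', ha'⟩, b'⟩ h
      cases b <;> cases b' <;> simp only [f, if_true, Bool.false_eq_true, if_false] at h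
      · subst h; rfl
      · subst h; rw [hi] at ha; exact absurd ha (not_lt.mpr ha'.le)
      · rw [← h, hi] at ha'; exact absurd ha' (not_lt.mpr ha.le)
      · have : a = a' := by rw [← hi a, h, hi]
        subst this; rfl
    · intro i
      rcases lt_or_gt_of_ne (hne i) with h | h
      · refine ⟨(⟨M i, by rw [hi]; exact h⟩, true), by simp [f, hi]⟩
      · exact ⟨(⟨i, h⟩, false), by simp [f]⟩
  let E := Equiv.ofBijective f hf
  have hc : Fintype.card (U k) = Fintype.card A := by
    have := Fintype.card_congr E
    simp only [Fintype.card_prod, Fintype.card_bool, Fintype.card_fin] at this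
    simp only [U, Fintype.card_option, ZMod.card]
    omega
  let g : U k ≃ A := Fintype.equivOfCardEq hc
  refine ⟨(g.prodCongr (Equiv.refl Bool)).trans E, ?_⟩
  intro u b
  cases b <;> simp [E, f, hi]

lemma main {k n : ℕ} (hk : 1 ≤ k) (hn : n = 4*k+4) (D : Fin n → Fin n → ℝ) (hD : IsDistMatrix D)
    (M : Fin n → Fin n) (hM : IsPM M) :
    ∃ s : TTP2Schedule n,
      s.total D ≤ (1 + 3 / (n : ℝ) - 6 / ((n : ℝ) * ((n : ℝ) - 2))) *
        (2 * sumPairs D + (n : ℝ) * pmWeight D M) := by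
  obtain ⟨e, he⟩ := exists_equiv hn M hM
  obtain ⟨d1, d2, d3, d4⟩ := hD
  set w := ww (fun x y => D (e x) (e y)) with hw
  let eσ : Equiv.Perm (U k) → (U k × Bool ≃ Fin n) := fun σ => (σ.prodCongr (Equiv.refl Bool)).trans e
  have hT : ∀ σ, (sched hk hn (eσ σ)).total D ≤ 2 * sumPairs D + n * pmWeight D M +
      ∑ s ∈ Finset.range (2*k+1), ∑ u, if cst k s u then w (σ u) (σ (P k s u)) else 0 := by
    intro σ
    refine total_le hk hn (eσ σ) D ⟨fun x => d1 _, fun x y => d2 _ _, fun x y => d3 _ _, fun x y z => d4 _ _ _⟩ M ?_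
    intro u b
    exact he _ _
  set W : ℝ := ∑ x, ∑ y, w x y - ∑ x, w x x with hW
  have hw0 : ∀ x y, 0 ≤ w x y := fun x y => by
    simp only [hw, ww, ex]
    exact add_nonneg (add_nonneg (d3 _ _) (d3 _ _)) (add_nonneg (d3 _ _) (d3 _ _))
  have hS : ∑ x, ∑ y, w x y = 2 * sumPairs D := by
    unfold sumPairs
    rw [mul_div_cancel₀ _ (two_ne_zero)]
    have h1 : ∀ i, ∑ j ∈ Finset.univ \ {i}, D i j = ∑ j, D i j := by
      intro i
      rw [← Finset.erase_eq]
      apply Finset.sum_erase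
      exact d1 i
    simp only [h1]
    rw [← e.sum_comp]
    simp only [← e.sum_comp (fun j => D _ j)]
    rw [Fintype.sum_prod_type]
    refine Finset.sum_congr rfl fun u _ => ?_
    simp only [Fintype.sum_prod_type, Fintype.sum_bool, ← Finset.sum_add_distrib]
    refine Finset.sum_congr rfl fun v _ => ?_
    simp only [hw, ww, ex, Bool.not_false, Bool.not_true]
    ring
  have hpm : 0 ≤ pmWeight D M := by
    unfold pmWeight
    exact div_nonneg (Finset.sum_nonneg fun i _ => d3 _ _) zero_le_two
  have hW1 : W ≤ 2 * sumPairs D := by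
    rw [hW, hS]
    have : 0 ≤ ∑ x, w x x := Finset.sum_nonneg fun x _ => hw0 _ _
    linarith
  have hW0 : 0 ≤ W := by
    rw [hW, ← Finset.sum_sub_distrib]
    refine Finset.sum_nonneg fun x _ => ?_
    have := Finset.single_le_sum (f := fun y => w x y) (fun y _ => hw0 x y) (Finset.mem_univ x)
    linarith
  have hcU : (Fintype.card (U k) : ℝ) = 2*k+2 := by
    simp only [U, Fintype.card_option, ZMod.card]; push_cast; ring
  set F : ℝ := (Fintype.card (Equiv.Perm (U k)) : ℝ) with hF
  have hkk : (1:ℝ) ≤ k := by exact_mod_cast hk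
  have hA : ∑ σ : Equiv.Perm (U k), (∑ s ∈ Finset.range (2*k+1), ∑ u, if cst k s u then w (σ u) (σ (P k s u)) else 0)
      ≤ ∑ σ : Equiv.Perm (U k), 3*k*W/((2*k+2)*(2*k+1)) := by
    have e1 : ∀ s : ℕ, ∀ u : U k, ∑ σ : Equiv.Perm (U k), (if cst k s u then w (σ u) (σ (P k s u)) else 0)
        = (if cst k s u then (1:ℝ) else 0) * (F * W/((2*k+2)*(2*k+1))) := by
      intro s u
      by_cases h : cst k s u = true
      · simp only [h, if_true]
        have := perm_avg w (P_ne (s : ZMod (2*k+1)) u).symm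
        rw [hcU] at this
        rw [one_mul, eq_div_iff (by positivity), ← this]
        ring
      · simp [h]
    have e2 : ∀ s : ℕ, ∑ σ : Equiv.Perm (U k), ∑ u, (if cst k s u then w (σ u) (σ (P k s u)) else 0)
        = (∑ u : U k, (if cst k s u then (1:ℝ) else 0)) * (F * W/((2*k+2)*(2*k+1))) := by
      intro s
      rw [Finset.sum_comm, Finset.sum_mul]
      exact Finset.sum_congr rfl fun u _ => e1 s u
    rw [Finset.sum_comm, Finset.sum_congr rfl (fun s _ => e2 s), ← Finset.sum_mul]
    rw [Finset.sum_const, nsmul_eq_mul, Finset.card_univ]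
    have hc := count_le hk
    have hp : 0 ≤ F * W/((2*k+2)*(2*k+1)) := by positivity
    refine (mul_le_mul_of_nonneg_right hc hp).trans (le_of_eq ?_)
    rw [← hF]; ring
  obtain ⟨σ, -, hσ⟩ := Finset.exists_le_of_sum_le Finset.univ_nonempty hA
  refine ⟨sched hk hn (eσ σ), (hT σ).trans ?_⟩
  have hb : 3*k*W/((2*k+2)*(2*k+1)) ≤ 3*k/((2*k+2)*(2*k+1)) * (2 * sumPairs D + n * pmWeight D M) := by
    rw [mul_div_right_comm]
    apply mul_le_mul_of_nonneg_left _ (by positivity)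
    have : (0:ℝ) ≤ n * pmWeight D M := by positivity
    linarith
  have hr : (1 + 3 / (n : ℝ) - 6 / ((n : ℝ) * ((n : ℝ) - 2))) = 1 + 3*k/((2*k+2)*(2*k+1)) := by
    have h1 : (n : ℝ) = 4*k+4 := by rw [hn]; push_cast; ring
    have h2 : (n : ℝ) - 2 = 2*(2*k+1) := by rw [h1]; ring
    rw [h2, h1]
    field_simp
    ring
  rw [hr, add_mul, one_mul]
  linarith

end TTP

/-- For every even `n ≥ 8` with `n ≡ 0 (mod 4)` and every distance
matrix `D`, there is a feasible TTP-2 schedule of total traveling distance at most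
`(1 + 3/n - 6/(n(n-2)))` times the independent lower bound `2·D_G + n·D_M`. -/
theorem ttp2_approx_independent_lower_bound (n : ℕ) (hn : Even n) (h8 : 8 ≤ n)
    (h4 : n % 4 = 0) (D : Fin n → Fin n → ℝ) (hD : IsDistMatrix D)
    (M : Fin n → Fin n) (hM : IsPM M)
    (hMmin : ∀ p : Fin n → Fin n, IsPM p → pmWeight D M ≤ pmWeight D p) :
    ∃ s : TTP2Schedule n,
      s.total D ≤ (1 + 3 / (n : ℝ) - 6 / ((n : ℝ) * ((n : ℝ) - 2))) *
        (2 * sumPairs D + (n : ℝ) * pmWeight D M) := by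
  obtain ⟨k, rfl⟩ : ∃ k, n = 4*k+4 := ⟨n/4 - 1, by omega⟩
  exact TTP.main (by omega) rfl D hD M hM
end

section
/- In any feasible TTP-2 schedule on n teams with distance matrix D (symmetric, nonnegative, zero diagonal, triangle inequality), the travel distance of each team i is at most 2·D_i, where D_i = Σ_{j=1}^n D_{i,j}. -/
open Finset

/-- In any feasible TTP-2 schedule, the travel distance of each
team `i` is at most `2·D_i` where `D_i = Σ_j D i j`. -/
theorem ttp2_travel_upper_bound (n : ℕ) (hn : Even n)
    (D : Fin n → Fin n → ℝ) (hD : IsDistMatrix D)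
    (s : TTP2Schedule n) (i : Fin n) :
    s.travel D i ≤ 2 * ∑ j, D i j := by
  obtain ⟨h0, hs, hnn, htri⟩ := hD
  have hn2 : 2 ≤ n := by
    have := i.isLt
    obtain ⟨k, hk⟩ := hn
    omega
  have key : ∀ k : ℕ, D i (s.venue 0 i) +
      (∑ d ∈ Finset.range k, D (s.venue d i) (s.venue (d + 1) i)) + D (s.venue k i) i
      ≤ 2 * ∑ d ∈ Finset.range (k + 1), D i (s.venue d i) := by
    intro k
    induction k with
    | zero =>
      simp only [Finset.sum_range_succ, Finset.sum_range_zero]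
      linarith [hs (s.venue 0 i) i]
    | succ k ih =>
      rw [Finset.sum_range_succ, Finset.sum_range_succ _ (k + 1)]
      linarith [hs (s.venue (k + 1) i) i, htri (s.venue k i) (s.venue (k + 1) i) i]
  have h1 := key (2 * (n - 1) - 1)
  have hm : 2 * (n - 1) - 1 + 1 = 2 * (n - 1) := by omega
  rw [hm] at h1
  have h2 : ∑ d ∈ Finset.range (2 * (n - 1)), D i (s.venue d i) ≤ ∑ j, D i j := by
    have h3 : ∑ d ∈ Finset.range (2 * (n - 1)), D i (s.venue d i)
        = ∑ d ∈ (Finset.range (2 * (n - 1))).filter (fun d => s.home d i = false),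
            D i (s.opp d i) := by
      rw [Finset.sum_filter]
      refine Finset.sum_congr rfl fun d _ => ?_
      unfold TTP2Schedule.venue
      cases s.home d i <;> simp [h0]
    have hinj : Set.InjOn (fun d => s.opp d i)
        ((Finset.range (2 * (n - 1))).filter (fun d => s.home d i = false) : Finset ℕ) := by
      intro a ha b hb hab
      simp only [Finset.coe_filter, Finset.mem_range, Set.mem_setOf_eq] at ha hb
      exact (s.plays_once i (s.opp b i) (s.opp_ne b hb.1 i).symm).unique
        ⟨ha.1, hab, ha.2⟩ ⟨hb.1, rfl, hb.2⟩
    rw [h3, ← Finset.sum_image (f := fun j => D i j) hinj]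
    exact Finset.sum_le_sum_of_subset_of_nonneg (Finset.subset_univ _) fun j _ _ => hnn i j
  unfold TTP2Schedule.travel
  linarith
end
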